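/- For every m ≥ 1 and all integers m_1, m_2 with 0 ≤ m_1, m_2 and m_1 + m_2 ≤ m, the image of the map ψ_{m,m_1,m_2} is an irreducible subset of CV(m) of dimension m² + m + 2. -/

import Mathlib

open MvPolynomial Matrix

noncomputable section

/-- Coordinates on the ambient affine space of `CV(m)`:
entries of `A`, entries of `B`, entries of `α`, entries of `β`, and `a, b`. -/
abbrev CVvar (m : ℕ) := (Fin m × Fin m) ⊕ (Fin m × Fin m) ⊕ Fin m ⊕ Fin m ⊕ Fin 2

/-- Points of the ambient affine space. -/
abbrev Pt (K : Type) (m : ℕ) := CVvar m → K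

/-- The Zariski topology on affine space `K^ι`: the closed sets are the zero loci of sets of
polynomials, i.e. the topology generated by the basic open sets `{x | p(x) ≠ 0}`. -/
def zariskiTopology (K : Type) [CommRing K] (ι : Type) : TopologicalSpace (ι → K) :=
  TopologicalSpace.generateFrom
    {U | ∃ p : MvPolynomial ι K, U = {x | MvPolynomial.eval x p ≠ 0}}

instance (K : Type) [Field K] (m : ℕ) : TopologicalSpace (Pt K m) :=
  zariskiTopology K (CVvar m)

/-- The matrix `A` of a point. -/
def Amat (K : Type) [Field K] (m : ℕ) (z : Pt K m) : Matrix (Fin m) (Fin m) K :=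
  Matrix.of fun i j => z (Sum.inl (i, j))

/-- The matrix `B` of a point. -/
def Bmat (K : Type) [Field K] (m : ℕ) (z : Pt K m) : Matrix (Fin m) (Fin m) K :=
  Matrix.of fun i j => z (Sum.inr (Sum.inl (i, j)))

/-- The column vector `α` of a point. -/
def alphav (K : Type) [Field K] (m : ℕ) (z : Pt K m) : Fin m → K :=
  fun i => z (Sum.inr (Sum.inr (Sum.inl i)))

/-- The row vector `β` of a point. -/
def betav (K : Type) [Field K] (m : ℕ) (z : Pt K m) : Fin m → K :=
  fun i => z (Sum.inr (Sum.inr (Sum.inr (Sum.inl i))))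

/-- The scalar `a` of a point. -/
def aval (K : Type) [Field K] (m : ℕ) (z : Pt K m) : K :=
  z (Sum.inr (Sum.inr (Sum.inr (Sum.inr 0))))

/-- The scalar `b` of a point. -/
def bval (K : Type) [Field K] (m : ℕ) (z : Pt K m) : K :=
  z (Sum.inr (Sum.inr (Sum.inr (Sum.inr 1))))

/-- `CV(m) = {(A,B,α,β,a,b) | AB = BA, Aα = aα, βB = bβ, βα = 0}`. -/
def CVset (K : Type) [Field K] (m : ℕ) : Set (Pt K m) :=
  {z | Amat K m z * Bmat K m z = Bmat K m z * Amat K m z ∧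
    (Amat K m z).mulVec (alphav K m z) = aval K m z • alphav K m z ∧
    Matrix.vecMul (betav K m z) (Bmat K m z) = bval K m z • betav K m z ∧
    ∑ i, betav K m z i * alphav K m z i = 0}

/-- The diagonal `diag(a₀ I_{m₁}, a₁, …, a_{m-m₁})`. -/
def diagA (K : Type) [Field K] (m m₁ : ℕ) (a : Fin (m - m₁ + 1) → K) : Fin m → K :=
  fun i => if h : (i : ℕ) < m₁ then a 0
    else a ⟨(i : ℕ) - m₁ + 1, by have := i.isLt; omega⟩

/-- The diagonal `diag(b₁, …, b_{m-m₂}, b₀ I_{m₂})`. -/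
def diagB (K : Type) [Field K] (m m₂ : ℕ) (b : Fin (m - m₂ + 1) → K) : Fin m → K :=
  fun i => if h : (i : ℕ) < m - m₂ then b ⟨(i : ℕ) + 1, by omega⟩ else b 0

/-- The column vector `(α, 0)ᵗ`. -/
def alphaFull (K : Type) [Field K] (m m₁ : ℕ) (α : Fin m₁ → K) : Fin m → K :=
  fun i => if h : (i : ℕ) < m₁ then α ⟨(i : ℕ), h⟩ else 0

/-- The row vector `(0, β)`. -/
def betaFull (K : Type) [Field K] (m m₂ : ℕ) (β : Fin m₂ → K) : Fin m → K :=
  fun i => if h : (i : ℕ) < m - m₂ then 0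
    else β ⟨(i : ℕ) - (m - m₂), by have := i.isLt; omega⟩

/-- The point `ψ_{m,m₁,m₂}(g, a, b, α, β)`. -/
def psiPoint (K : Type) [Field K] (m m₁ m₂ : ℕ) (g : GL (Fin m) K)
    (a : Fin (m - m₁ + 1) → K) (b : Fin (m - m₂ + 1) → K)
    (α : Fin m₁ → K) (β : Fin m₂ → K) : Pt K m :=
  fun s =>
    match s with
    | Sum.inl (i, j) =>
        ((g : Matrix (Fin m) (Fin m) K) * Matrix.diagonal (diagA K m m₁ a) *
          ((g⁻¹ : GL (Fin m) K) : Matrix (Fin m) (Fin m) K)) i j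
    | Sum.inr (Sum.inl (i, j)) =>
        ((g : Matrix (Fin m) (Fin m) K) * Matrix.diagonal (diagB K m m₂ b) *
          ((g⁻¹ : GL (Fin m) K) : Matrix (Fin m) (Fin m) K)) i j
    | Sum.inr (Sum.inr (Sum.inl i)) =>
        ((g : Matrix (Fin m) (Fin m) K)).mulVec (alphaFull K m m₁ α) i
    | Sum.inr (Sum.inr (Sum.inr (Sum.inl i))) =>
        Matrix.vecMul (betaFull K m m₂ β)
          ((g⁻¹ : GL (Fin m) K) : Matrix (Fin m) (Fin m) K) i
    | Sum.inr (Sum.inr (Sum.inr (Sum.inr 0))) => a 0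
    | Sum.inr (Sum.inr (Sum.inr (Sum.inr 1))) => b 0

/-- The image of `ψ_{m,m₁,m₂}` (with `Λ_i` the set of tuples with pairwise distinct
coordinates, i.e. injective functions). -/
def psiImage (K : Type) [Field K] (m m₁ m₂ : ℕ) : Set (Pt K m) :=
  {z | ∃ (g : GL (Fin m) K) (a : Fin (m - m₁ + 1) → K) (b : Fin (m - m₂ + 1) → K)
      (α : Fin m₁ → K) (β : Fin m₂ → K),
    Function.Injective a ∧ Function.Injective b ∧ z = psiPoint K m m₁ m₂ g a b α β}

/-- An injective integral extension preserves the Krull dimension. -/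
theorem ringKrullDim_eq_of_isIntegral (R S : Type*) [CommRing R] [CommRing S] [Algebra R S]
    [Algebra.IsIntegral R S] [FaithfulSMul R S] : ringKrullDim R = ringKrullDim S := by
  apply le_antisymm
  · refine iSup_le fun l => ?_
    obtain ⟨⟨P, hP, hl⟩⟩ := Ideal.nonempty_primesOver (S := S) (RelSeries.head l).asIdeal
    obtain ⟨L, hL, -⟩ := Ideal.exists_ltSeries_of_hasGoingUp l P
    rw [← hL]
    exact Order.LTSeries.length_le_krullDim L
  · exact Order.krullDim_le_of_strictMono (PrimeSpectrum.comap (algebraMap R S))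
      fun P Q hPQ => Ideal.IsIntegral.comap_lt_comap hPQ

/-- The Krull dimension of a finitely generated domain over a field is its transcendence degree. -/
theorem ringKrullDim_eq_of_trdeg_eq {k A : Type} [Field k] [CommRing A] [IsDomain A] [Algebra k A]
    [Algebra.FiniteType k A] {n : ℕ} (hn : Algebra.trdeg k A = n) : ringKrullDim A = n := by
  obtain ⟨s, g, hg, hint⟩ := exists_integral_inj_algHom_of_fg k A
  algebraize [g.toRingHom]
  have hint' : Algebra.IsIntegral (MvPolynomial (Fin s) k) A := ⟨hint⟩
  have : FaithfulSMul (MvPolynomial (Fin s) k) A :=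
    (faithfulSMul_iff_algebraMap_injective _ _).2 hg
  have : IsScalarTower k (MvPolynomial (Fin s) k) A :=
    .of_algebraMap_eq fun x => (g.commutes x).symm
  have h1 := trdeg_add_eq k (MvPolynomial (Fin s) k) (A := A)
  rw [trdeg_eq_zero (R := MvPolynomial (Fin s) k) (A := A), hn] at h1
  have h2 : s = n := by simpa using h1
  rw [← ringKrullDim_eq_of_isIntegral (MvPolynomial (Fin s) k) A,
    MvPolynomial.ringKrullDim_of_isNoetherianRing]
  simp [h2]

section Zariski

variable {K ι : Type} [Field K] [t : TopologicalSpace (ι → K)]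

theorem isTopologicalBasis_zariskiTopology (ht : t = zariskiTopology K ι) :
    TopologicalSpace.IsTopologicalBasis
      {U : Set (ι → K) | ∃ p : MvPolynomial ι K, U = {x | eval x p ≠ 0}} := by
  refine TopologicalSpace.isTopologicalBasis_of_subbasis_of_finiteInter ht ⟨⟨1, by simp⟩, ?_⟩
  rintro _ ⟨p, rfl⟩ _ ⟨q, rfl⟩
  exact ⟨p * q, by ext x; simp⟩

theorem closure_eq_zeroLocus (ht : t = zariskiTopology K ι) (V : Set (ι → K)) :
    closure V = zeroLocus K (vanishingIdeal K V) := by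
  ext x
  simp only [(isTopologicalBasis_zariskiTopology ht).mem_closure_iff, mem_zeroLocus_iff,
    mem_vanishingIdeal_iff, Set.mem_ofPred_eq, forall_exists_index, forall_eq_apply_imp_iff]
  refine forall_congr' fun p => ?_
  rw [← not_imp_not, not_not, Set.not_nonempty_iff_eq_empty, Set.eq_empty_iff_forall_notMem]
  simp only [Set.mem_inter_iff, Set.mem_ofPred_eq, not_and', not_not]
  rfl

theorem isClosed_zeroLocus (ht : t = zariskiTopology K ι) (I : Ideal (MvPolynomial ι K)) :
    IsClosed (zeroLocus K I) := by
  rw [← closure_subset_iff_isClosed, closure_eq_zeroLocus ht]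
  exact zeroLocus_anti_mono (le_vanishingIdeal_zeroLocus I)

theorem isIrreducible_iff_isPrime_vanishingIdeal (ht : t = zariskiTopology K ι)
    (V : Set (ι → K)) : IsIrreducible V ↔ (vanishingIdeal K V).IsPrime := by
  have hopen (p : MvPolynomial ι K) : IsOpen {x : ι → K | eval x p ≠ 0} :=
    (isTopologicalBasis_zariskiTopology ht).isOpen ⟨p, rfl⟩
  constructor
  · rintro ⟨⟨v, hv⟩, hV⟩
    refine ⟨fun h => ?_, fun {p q} hpq => ?_⟩
    · have := (h ▸ Submodule.mem_top : (1 : MvPolynomial ι K) ∈ vanishingIdeal K V) v hv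
      simp at this
    · by_contra! hcon
      simp only [mem_vanishingIdeal_iff, not_forall] at hcon hpq
      obtain ⟨⟨x, hx, hpx⟩, ⟨y, hy, hqy⟩⟩ := hcon
      obtain ⟨z, hz, hpz, hqz⟩ := hV _ _ (hopen p) (hopen q) ⟨x, hx, hpx⟩ ⟨y, hy, hqy⟩
      have := hpq z hz
      simp_all
  · intro hV
    refine ⟨?_, ?_⟩
    · rw [Set.nonempty_iff_ne_empty]
      rintro rfl
      exact hV.ne_top vanishingIdeal_empty
    · rintro U W hU hW ⟨x, hx, hxU⟩ ⟨y, hy, hyW⟩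
      obtain ⟨_, ⟨p, rfl⟩, hpx, hpU⟩ :=
        (isTopologicalBasis_zariskiTopology ht).exists_subset_of_mem_open hxU hU
      obtain ⟨_, ⟨q, rfl⟩, hqy, hqW⟩ :=
        (isTopologicalBasis_zariskiTopology ht).exists_subset_of_mem_open hyW hW
      have hpq : p * q ∉ vanishingIdeal K V := fun h => (hV.mem_or_mem h).elim
        (fun h => hpx (h x hx)) (fun h => hqy (h y hy))
      simp only [mem_vanishingIdeal_iff, not_forall, map_mul,
        mul_eq_zero, not_or] at hpq
      obtain ⟨z, hz, hpz, hqz⟩ := hpq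
      exact ⟨z, hz, hpU hpz, hqW hqz⟩

theorem Topology.IsInducing.isIrreducible_of_image {X Y : Type*} [TopologicalSpace X]
    [TopologicalSpace Y] {f : X → Y} (hf : IsInducing f) {s : Set X} (hs : IsIrreducible (f '' s)) :
    IsIrreducible s := by
  refine ⟨hs.1.of_image, fun U W hU hW => ?_⟩
  obtain ⟨U, hU', rfl⟩ := hf.isOpen_iff.1 hU
  obtain ⟨W, hW', rfl⟩ := hf.isOpen_iff.1 hW
  rintro ⟨x, hx, hxU⟩ ⟨y, hy, hyW⟩
  obtain ⟨_, ⟨z, hz, rfl⟩, hzU, hzW⟩ := hs.2 _ _ hU' hW' ⟨_, ⟨x, hx, rfl⟩, hxU⟩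
    ⟨_, ⟨y, hy, rfl⟩, hyW⟩
  exact ⟨z, hz, hzU, hzW⟩

/-- The dimension of the Zariski closure of `V` is that of its coordinate ring. -/
theorem topologicalKrullDim_closure_eq [IsAlgClosed K] [Finite ι] (ht : t = zariskiTopology K ι)
    (V : Set (ι → K)) :
    topologicalKrullDim ↥(closure V) = ringKrullDim (MvPolynomial ι K ⧸ vanishingIdeal K V) := by
  rw [ringKrullDim_quotient, ← Order.krullDim_orderDual]
  have hcl : IsClosed (closure V) := isClosed_closure
  apply le_antisymm
  · have hind := Topology.IsInducing.subtypeVal (t := closure V)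
    have hirr (Z : TopologicalSpace.IrreducibleCloseds (closure V)) :
        (vanishingIdeal K (Subtype.val '' (Z : Set (closure V)))).IsPrime :=
      (isIrreducible_iff_isPrime_vanishingIdeal ht _).1
        (Z.isIrreducible.image _ continuous_subtype_val.continuousOn)
    have hZ (Z : TopologicalSpace.IrreducibleCloseds (closure V)) :
        zeroLocus K (vanishingIdeal K (Subtype.val '' (Z : Set (closure V)))) =
          Subtype.val '' (Z : Set (closure V)) := by
      rw [← closure_eq_zeroLocus ht]
      exact (hcl.isClosedEmbedding_subtypeVal.isClosedMap _ Z.isClosed).closure_eq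
    let f (Z : TopologicalSpace.IrreducibleCloseds (closure V)) :
        (PrimeSpectrum.zeroLocus (vanishingIdeal K V : Set (MvPolynomial ι K)))ᵒᵈ :=
      OrderDual.toDual ⟨⟨_, hirr Z⟩, by
        refine le_zeroLocus_iff_le_vanishingIdeal.1 ?_
        rw [← closure_eq_zeroLocus ht]
        rintro _ ⟨x, -, rfl⟩
        exact x.2⟩
    refine Order.krullDim_le_of_strictMono f
      (Monotone.strictMono_of_injective (fun Z W h => ?_) fun Z W h => ?_)
    · exact vanishingIdeal_anti_mono (Set.image_mono h)
    · have h' : vanishingIdeal K (Subtype.val '' (Z : Set (closure V))) =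
        vanishingIdeal K (Subtype.val '' (W : Set (closure V))) :=
        congrArg (fun P => (OrderDual.ofDual P).1.asIdeal) h
      apply TopologicalSpace.IrreducibleCloseds.ext
      apply Subtype.val_injective.image_injective
      rw [← hZ Z, ← hZ W, h']
  · have hsub (P : PrimeSpectrum.zeroLocus (vanishingIdeal K V : Set (MvPolynomial ι K))) :
        zeroLocus K P.1.asIdeal ⊆ closure V := by
      rw [closure_eq_zeroLocus ht]
      exact zeroLocus_anti_mono P.2
    have himg (P : PrimeSpectrum.zeroLocus (vanishingIdeal K V : Set (MvPolynomial ι K))) :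
        Subtype.val '' (Subtype.val ⁻¹' zeroLocus K P.1.asIdeal : Set (closure V)) =
          zeroLocus K P.1.asIdeal := by
      rw [Subtype.image_preimage_coe, Set.inter_eq_right.2 (hsub P)]
    have hirr (P : PrimeSpectrum.zeroLocus (vanishingIdeal K V : Set (MvPolynomial ι K))) :
        IsIrreducible (Subtype.val ⁻¹' zeroLocus K P.1.asIdeal : Set (closure V)) := by
      apply Topology.IsInducing.subtypeVal.isIrreducible_of_image
      rw [himg, isIrreducible_iff_isPrime_vanishingIdeal ht, IsPrime.vanishingIdeal_zeroLocus]
      exact P.1.isPrime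
    let f (P : (PrimeSpectrum.zeroLocus (vanishingIdeal K V : Set (MvPolynomial ι K)))ᵒᵈ) :
        TopologicalSpace.IrreducibleCloseds (closure V) :=
      ⟨_, hirr (OrderDual.ofDual P),
        (isClosed_zeroLocus ht _).preimage continuous_subtype_val⟩
    refine Order.krullDim_le_of_strictMono f
      (Monotone.strictMono_of_injective (fun P Q h => ?_) fun P Q h => ?_)
    · intro x hx
      exact zeroLocus_anti_mono (show (OrderDual.ofDual Q).1.asIdeal ≤
        (OrderDual.ofDual P).1.asIdeal from h) hx
    · have h' := congrArg (fun Z : TopologicalSpace.IrreducibleCloseds (closure V) =>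
        vanishingIdeal K (Subtype.val '' (Z : Set (closure V)))) h
      have h'' : vanishingIdeal K (zeroLocus K (OrderDual.ofDual P).1.asIdeal) =
          vanishingIdeal K (zeroLocus K (OrderDual.ofDual Q).1.asIdeal) := by
        rw [← himg (OrderDual.ofDual P), ← himg (OrderDual.ofDual Q)]
        exact h'
      rw [IsPrime.vanishingIdeal_zeroLocus, IsPrime.vanishingIdeal_zeroLocus] at h''
      exact OrderDual.ofDual.injective (Subtype.ext (PrimeSpectrum.ext h''))

end Zariski

section ConjPoint

variable {m : ℕ} {R L : Type} [CommRing R] [CommRing L]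

/-- The tuple `(G·diag(d)·H, G·diag(e)·H, c·Gu, vH, c·a, c·b)`; for `H = G⁻¹` and `c = 1` it has the
shape of the values of `psiPoint`, while for `H = adj G` and `c = det G` it collects the numerators
of such a value. -/
def conjPoint (G H : Matrix (Fin m) (Fin m) R) (c : R) (d e u v : Fin m → R) (a b : R) :
    CVvar m → R
  | Sum.inl (i, j) => (G * Matrix.diagonal d * H) i j
  | Sum.inr (Sum.inl (i, j)) => (G * Matrix.diagonal e * H) i j
  | Sum.inr (Sum.inr (Sum.inl i)) => c * (G *ᵥ u) i
  | Sum.inr (Sum.inr (Sum.inr (Sum.inl i))) => (v ᵥ* H) i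
  | Sum.inr (Sum.inr (Sum.inr (Sum.inr i))) => c * ![a, b] i

theorem psiPoint_eq_conjPoint {K : Type} [Field K] (m₁ m₂ : ℕ) (g : GL (Fin m) K)
    (a : Fin (m - m₁ + 1) → K) (b : Fin (m - m₂ + 1) → K) (α : Fin m₁ → K) (β : Fin m₂ → K) :
    psiPoint K m m₁ m₂ g a b α β =
      conjPoint g.val g⁻¹.val 1 (diagA K m m₁ a) (diagB K m m₂ b) (alphaFull K m m₁ α)
        (betaFull K m m₂ β) (a 0) (b 0) := by
  funext s
  rcases s with ⟨i, j⟩ | ⟨i, j⟩ | i | i | i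
  · rfl
  · rfl
  · simp [psiPoint, conjPoint]
  · rfl
  · fin_cases i <;> simp [psiPoint, conjPoint]

theorem conjPoint_smul (G H : Matrix (Fin m) (Fin m) R) (c : R) (d e u v : Fin m → R) (a b : R)
    (s : CVvar m) :
    conjPoint G (c • H) c d e u v a b s = c * conjPoint G H 1 d e u v a b s := by
  rcases s with ⟨i, j⟩ | ⟨i, j⟩ | i | i | i <;> simp [conjPoint, Matrix.vecMul_smul]

theorem map_conjPoint (φ : R →+* L) (G H : Matrix (Fin m) (Fin m) R) (c : R)
    (d e u v : Fin m → R) (a b : R) (s : CVvar m) :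
    φ (conjPoint G H c d e u v a b s) =
      conjPoint (G.map φ) (H.map φ) (φ c) (φ ∘ d) (φ ∘ e) (φ ∘ u) (φ ∘ v) (φ a) (φ b) s := by
  rcases s with ⟨i, j⟩ | ⟨i, j⟩ | i | i | i
  · simp [conjPoint, Matrix.mul_apply, Matrix.diagonal_apply]
  · simp [conjPoint, Matrix.mul_apply, Matrix.diagonal_apply]
  · simp [conjPoint, Matrix.mulVec, dotProduct]
  · simp [conjPoint, Matrix.vecMul, dotProduct]
  · fin_cases i <;> simp [conjPoint]

/-- Rescaling the columns of `g` by `t`. -/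
theorem conjPoint_mul_diagonal (G H : Matrix (Fin m) (Fin m) R) (c : R)
    (t t' d e u v : Fin m → R) (a b : R) (ht : t * t' = 1) :
    conjPoint (G * Matrix.diagonal t) (Matrix.diagonal t' * H) c d e (t' * u) (t * v) a b =
      conjPoint G H c d e u v a b := by
  have ht' (i : Fin m) : t i * t' i = 1 := congrFun ht i
  have key (d : Fin m → R) : G * Matrix.diagonal t * Matrix.diagonal d *
      (Matrix.diagonal t' * H) = G * Matrix.diagonal d * H := by
    simp only [Matrix.mul_assoc]
    congr 1
    simp only [← Matrix.mul_assoc, Matrix.diagonal_mul_diagonal]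
    congr 2
    funext i
    linear_combination d i * ht' i
  have hu : Matrix.diagonal t *ᵥ (t' * u) = u := by
    funext i
    simp only [Matrix.mulVec_diagonal, Pi.mul_apply]
    linear_combination u i * ht' i
  have hv : (t * v) ᵥ* Matrix.diagonal t' = v := by
    funext i
    simp only [Matrix.vecMul_diagonal, Pi.mul_apply]
    linear_combination v i * ht' i
  funext s
  rcases s with ⟨i, j⟩ | ⟨i, j⟩ | i | i | i
  · simp only [conjPoint, key]
  · simp only [conjPoint, key]
  · simp only [conjPoint, ← Matrix.mulVec_mulVec, hu]
  · simp only [conjPoint, ← Matrix.vecMul_vecMul, hv]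
  · rfl

end ConjPoint

section Generic

variable {K τ : Type} [Field K] {m : ℕ}

theorem exists_clear_denominators {σ : Type} (f : MvPolynomial τ K) (r : σ → MvPolynomial τ K)
    (p : MvPolynomial σ K) :
    ∃ (N : ℕ) (q : MvPolynomial τ K), ∀ (L : Type) [CommRing L] [Algebra K L]
      (φ : MvPolynomial τ K →ₐ[K] L) (w : σ → L), (∀ s, φ f * w s = φ (r s)) →
        φ f ^ N * aeval w p = φ q := by
  induction p using MvPolynomial.induction_on with
  | C c => exact ⟨0, C c, fun L _ _ φ w _ => by simp [MvPolynomial.algHom_C]⟩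
  | add p p' hp hp' =>
    obtain ⟨N, q, hq⟩ := hp
    obtain ⟨N', q', hq'⟩ := hp'
    refine ⟨N + N', f ^ N' * q + f ^ N * q', fun L _ _ φ w hw => ?_⟩
    simp only [map_add, map_mul, map_pow, ← hq L φ w hw, ← hq' L φ w hw]
    ring
  | mul_X p s hp =>
    obtain ⟨N, q, hq⟩ := hp
    refine ⟨N + 1, q * r s, fun L _ _ φ w hw => ?_⟩
    simp only [map_mul, ← hq L φ w hw, ← hw, aeval_X]
    ring

/-- A polynomial condition on the values of `conjPoint` at an invertible matrix depending
polynomially on parameters is equivalent to a polynomial condition on the parameters. -/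
theorem exists_numerator (G : Matrix (Fin m) (Fin m) (MvPolynomial τ K))
    (d e u v : Fin m → MvPolynomial τ K) (a b : MvPolynomial τ K)
    (p : MvPolynomial (CVvar m) K) :
    ∃ q : MvPolynomial τ K, ∀ (L : Type) [CommRing L] [Algebra K L]
      (φ : MvPolynomial τ K →ₐ[K] L) (g : GL (Fin m) L), g.val = G.map φ →
        (aeval (conjPoint g.val g⁻¹.val 1 (φ ∘ d) (φ ∘ e) (φ ∘ u) (φ ∘ v) (φ a) (φ b)) p = 0 ↔
          φ q = 0) := by
  obtain ⟨N, q, hq⟩ :=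
    exists_clear_denominators G.det (conjPoint G G.adjugate G.det d e u v a b) p
  refine ⟨q, fun L _ _ φ g hg => ?_⟩
  have hdet : φ G.det = g.val.det := by
    rw [hg, AlgHom.map_det]
    rfl
  have hadj : G.adjugate.map φ = g.val.det • g⁻¹.val := by
    have h1 : G.adjugate.map φ = g.val.adjugate := by
      rw [hg]
      exact φ.map_adjugate G
    calc G.adjugate.map φ = g.val.adjugate * (g.val * g⁻¹.val) := by
          rw [h1, Units.mul_inv, mul_one]
      _ = _ := by rw [← mul_assoc, Matrix.adjugate_mul, Matrix.smul_mul, one_mul]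
  rw [← hq L φ (conjPoint g.val g⁻¹.val 1 (φ ∘ d) (φ ∘ e) (φ ∘ u) (φ ∘ v) (φ a) (φ b)) fun s => ?_,
    hdet]
  · exact (((Matrix.isUnits_det_units g).pow N).mul_right_eq_zero).symm
  · have := map_conjPoint φ.toRingHom G G.adjugate G.det d e u v a b s
    simp only [AlgHom.toRingHom_eq_coe, RingHom.coe_coe] at this
    rw [this, hadj, ← hg, hdet, conjPoint_smul]

theorem exists_eval_ne_zero [Infinite K] {p : MvPolynomial τ K} (hp : p ≠ 0) :
    ∃ x, eval x p ≠ 0 := by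
  by_contra! h
  exact hp (MvPolynomial.funext fun x => by simpa using h x)

/-- A polynomial vanishing at sufficiently many specializations of a generic `conjPoint` vanishes
at all of its specializations. -/
theorem aeval_conjPoint_eq_zero [Infinite K] (G : Matrix (Fin m) (Fin m) (MvPolynomial τ K))
    (hG : G.det ≠ 0) (d e u v : Fin m → MvPolynomial τ K) (a b : MvPolynomial τ K)
    {h : MvPolynomial τ K} (hh : h ≠ 0) (p : MvPolynomial (CVvar m) K)
    (hp : ∀ (x : τ → K) (g : GL (Fin m) K), g.val = G.map (aeval x) → aeval x h ≠ 0 →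
      aeval (conjPoint g.val g⁻¹.val 1 (aeval x ∘ d) (aeval x ∘ e) (aeval x ∘ u) (aeval x ∘ v)
        (aeval x a) (aeval x b)) p = 0)
    {L : Type} [CommRing L] [Algebra K L] (φ : MvPolynomial τ K →ₐ[K] L) (g : GL (Fin m) L)
    (hg : g.val = G.map φ) :
    aeval (conjPoint g.val g⁻¹.val 1 (φ ∘ d) (φ ∘ e) (φ ∘ u) (φ ∘ v) (φ a) (φ b)) p = 0 := by
  obtain ⟨q, hq⟩ := exists_numerator G d e u v a b p
  rw [hq L φ g hg]
  suffices q = 0 by rw [this, map_zero]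
  by_contra hq0
  obtain ⟨x, hx⟩ := exists_eval_ne_zero (mul_ne_zero (mul_ne_zero hq0 hh) hG)
  simp only [map_mul, mul_ne_zero_iff] at hx
  obtain ⟨⟨hx1, hx2⟩, hx3⟩ := hx
  have hdet : (G.map (aeval x : MvPolynomial τ K →ₐ[K] K)).det ≠ 0 := by
    have := AlgHom.map_det (aeval x : MvPolynomial τ K →ₐ[K] K) G
    rw [AlgHom.mapMatrix_apply] at this
    rw [← this]
    exact hx3
  exact hx1 ((hq K (aeval x) (Matrix.GeneralLinearGroup.mkOfDetNeZero _ hdet) rfl).1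
    (hp x _ rfl hx2))

end Generic

section Slice

variable {K : Type} [Field K] {m : ℕ} (m₁ m₂ : ℕ)

/-- The position in `(a₀, …, a_{m-m₁})` of the `i`-th diagonal entry of the first matrix. -/
def diagIdxA (i : Fin m) : Fin (m - m₁ + 1) :=
  if h : (i : ℕ) < m₁ then 0 else ⟨(i : ℕ) - m₁ + 1, by have := i.isLt; omega⟩

/-- The position in `(b₀, …, b_{m-m₂})` of the `i`-th diagonal entry of the second matrix. -/
def diagIdxB (i : Fin m) : Fin (m - m₂ + 1) :=
  if h : (i : ℕ) < m - m₂ then ⟨(i : ℕ) + 1, by omega⟩ else 0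

theorem diagA_eq_comp (a : Fin (m - m₁ + 1) → K) : diagA K m m₁ a = a ∘ diagIdxA m₁ := by
  funext i
  simp only [diagA, diagIdxA, Function.comp_apply]
  split <;> rfl

theorem diagB_eq_comp (b : Fin (m - m₂ + 1) → K) : diagB K m m₂ b = b ∘ diagIdxB m₂ := by
  funext i
  simp only [diagB, diagIdxB, Function.comp_apply]
  split <;> rfl

/-- Distinct positions are separated by one of the two diagonals. -/
theorem diagIdx_ne (h : m₁ + m₂ ≤ m) {i j : Fin m} (hij : i ≠ j) :
    diagIdxA m₁ i ≠ diagIdxA m₁ j ∨ diagIdxB m₂ i ≠ diagIdxB m₂ j := by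
  have hij' : (i : ℕ) ≠ j := Fin.val_injective.ne hij
  have hi := i.isLt
  have hj := j.isLt
  simp only [diagIdxA, diagIdxB]
  split_ifs <;> simp [Fin.ext_iff] <;> omega

/-- Extension of a column vector by zero, as in `alphaFull`, over any ring. -/
def extendAlpha {R : Type} [Zero R] (α : Fin m₁ → R) : Fin m → R :=
  fun i => if h : (i : ℕ) < m₁ then α ⟨(i : ℕ), h⟩ else 0

/-- Extension of a row vector by zero, as in `betaFull`, over any ring. -/
def extendBeta {R : Type} [Zero R] (β : Fin m₂ → R) : Fin m → R :=
  fun i => if h : (i : ℕ) < m - m₂ then 0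
    else β ⟨(i : ℕ) - (m - m₂), by have := i.isLt; omega⟩

theorem map_comp_extendAlpha {R L : Type} [CommRing R] [Field L] (φ : R →+* L) (α : Fin m₁ → R) :
    φ ∘ (extendAlpha m₁ α : Fin m → R) = alphaFull L m m₁ (φ ∘ α) := by
  funext i
  simp only [extendAlpha, alphaFull, Function.comp_apply]
  split <;> simp

theorem map_comp_extendBeta {R L : Type} [CommRing R] [Field L] (φ : R →+* L) (β : Fin m₂ → R) :
    φ ∘ (extendBeta m₂ β : Fin m → R) = betaFull L m m₂ (φ ∘ β) := by
  funext i
  simp only [extendBeta, betaFull, Function.comp_apply]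
  split <;> simp

theorem alphaFull_mul (h : m₁ ≤ m) (t : Fin m → K) (α : Fin m₁ → K) :
    t * alphaFull K m m₁ α = alphaFull K m m₁ fun k => t (Fin.castLE h k) * α k := by
  funext i
  simp only [alphaFull, Pi.mul_apply]
  split
  · rfl
  · rw [mul_zero]

theorem betaFull_mul (h : m₂ ≤ m) (t : Fin m → K) (β : Fin m₂ → K) :
    t * betaFull K m m₂ β =
      betaFull K m m₂ fun k => t ⟨(m - m₂) + k, by have := k.isLt; omega⟩ * β k := by
  funext i
  simp only [betaFull, Pi.mul_apply]
  split
  · rw [mul_zero]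
  · congr 2
    ext
    simp only
    omega

/-- Parameters of `psiPoint` for matrices whose `r`-th row consists of ones. -/
abbrev SliceVar (m m₁ m₂ : ℕ) (r : Fin m) :=
  {p : Fin m × Fin m // p.1 ≠ r} ⊕ Fin (m - m₁ + 1) ⊕ Fin (m - m₂ + 1) ⊕ Fin m₁ ⊕ Fin m₂

theorem card_sliceVar (h₁ : m₁ ≤ m) (h₂ : m₂ ≤ m) (r : Fin m) :
    Fintype.card (SliceVar m m₁ m₂ r) = m ^ 2 + m + 2 := by
  have h : Fintype.card {p : Fin m × Fin m // p.1 ≠ r} + m = m ^ 2 := by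
    have h1 := Fintype.card_subtype_compl fun p : Fin m × Fin m => p.1 = r
    have h2 : Fintype.card {p : Fin m × Fin m // p.1 = r} = m := by
      refine (Fintype.card_congr (β := Fin m)
        ⟨fun p => p.1.2, fun j => ⟨(r, j), rfl⟩, ?_, fun j => rfl⟩).trans (Fintype.card_fin m)
      rintro ⟨⟨i, j⟩, rfl⟩
      rfl
    have h3 := Fintype.card_subtype_le fun p : Fin m × Fin m => p.1 = r
    simp only [Fintype.card_prod, Fintype.card_fin] at h1 h3
    rw [h2] at h1 h3
    rw [pow_two]
    simp only [ne_eq]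
    omega
  simp only [Fintype.card_sum, Fintype.card_fin]
  omega

variable (K) {m₁ m₂} {r : Fin m}

/-- The generic matrix whose `r`-th row consists of ones. -/
def sliceMatrix (m₁ m₂ : ℕ) (r : Fin m) :
    Matrix (Fin m) (Fin m) (MvPolynomial (SliceVar m m₁ m₂ r) K) :=
  Matrix.of fun i j => if h : i = r then 1 else X (Sum.inl ⟨(i, j), h⟩)

theorem det_sliceMatrix_ne_zero : (sliceMatrix K m₁ m₂ r).det ≠ 0 := by
  let x : SliceVar m m₁ m₂ r → K := fun s => match s with
    | Sum.inl p => if p.1.1 = p.1.2 then 1 else 0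
    | Sum.inr _ => 0
  have hx : (sliceMatrix K m₁ m₂ r).map (eval x) =
      Matrix.updateRow (1 : Matrix (Fin m) (Fin m) K) r fun _ => 1 := by
    ext i j
    by_cases h : i = r
    · subst h
      simp [sliceMatrix]
    · simp [sliceMatrix, h, x, Matrix.one_apply]
  intro h
  have := RingHom.map_det (eval x) (sliceMatrix K m₁ m₂ r)
  rw [RingHom.mapMatrix_apply, hx, ← Matrix.cramer_transpose_apply, h] at this
  simp at this

/-- The value of `ψ` at the slice parameters `x`, with `g` the matrix given by `x`. -/
abbrev slicePoint {L : Type} [Field L] (g : GL (Fin m) L) (x : SliceVar m m₁ m₂ r → L) : Pt L m :=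
  psiPoint L m m₁ m₂ g (fun k => x (Sum.inr (Sum.inl k)))
    (fun k => x (Sum.inr (Sum.inr (Sum.inl k))))
    (fun k => x (Sum.inr (Sum.inr (Sum.inr (Sum.inl k)))))
    (fun k => x (Sum.inr (Sum.inr (Sum.inr (Sum.inr k)))))

theorem slicePoint_eq_conjPoint {L : Type} [Field L] [Algebra K L]
    (φ : MvPolynomial (SliceVar m m₁ m₂ r) K →ₐ[K] L) (g : GL (Fin m) L) :
    slicePoint g (fun s => φ (X s)) =
      conjPoint g.val g⁻¹.val 1
        (φ ∘ fun i => X (Sum.inr (Sum.inl (diagIdxA m₁ i))))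
        (φ ∘ fun i => X (Sum.inr (Sum.inr (Sum.inl (diagIdxB m₂ i)))))
        (φ ∘ extendAlpha m₁ fun k => X (Sum.inr (Sum.inr (Sum.inr (Sum.inl k)))))
        (φ ∘ extendBeta m₂ fun k => X (Sum.inr (Sum.inr (Sum.inr (Sum.inr k)))))
        (φ (X (Sum.inr (Sum.inl 0)))) (φ (X (Sum.inr (Sum.inr (Sum.inl 0))))) := by
  have h1 := map_comp_extendAlpha (m := m) m₁ φ.toRingHom fun k =>
    X (Sum.inr (Sum.inr (Sum.inr (Sum.inl k))))
  have h2 := map_comp_extendBeta (m := m) m₂ φ.toRingHom fun k =>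
    X (Sum.inr (Sum.inr (Sum.inr (Sum.inr k))))
  simp only [AlgHom.toRingHom_eq_coe, RingHom.coe_coe] at h1 h2
  rw [slicePoint, psiPoint_eq_conjPoint, diagA_eq_comp, diagB_eq_comp, h1, h2]
  rfl

variable {K}

/-- Rescaling columns brings a matrix with nowhere vanishing `r`-th row into the slice. -/
theorem exists_slicePoint_eq (h : m₁ + m₂ ≤ m) (g : GL (Fin m) K) (hg : ∀ j, g.val r j ≠ 0)
    (a : Fin (m - m₁ + 1) → K) (b : Fin (m - m₂ + 1) → K) (α : Fin m₁ → K) (β : Fin m₂ → K) :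
    ∃ (x : SliceVar m m₁ m₂ r → K) (g' : GL (Fin m) K),
      g'.val = (sliceMatrix K m₁ m₂ r).map (aeval x) ∧
        slicePoint g' x = psiPoint K m m₁ m₂ g a b α β := by
  let t : Fin m → K := fun j => (g.val r j)⁻¹
  let t' : Fin m → K := fun j => g.val r j
  have ht : t * t' = 1 := funext fun j => inv_mul_cancel₀ (hg j)
  let T : GL (Fin m) K := ⟨Matrix.diagonal t, Matrix.diagonal t', by
      rw [Matrix.diagonal_mul_diagonal, ← Matrix.diagonal_one, ← Pi.one_def, ← ht, Pi.mul_def], by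
      rw [Matrix.diagonal_mul_diagonal, ← Matrix.diagonal_one, ← Pi.one_def, ← ht, mul_comm t t',
        Pi.mul_def]⟩
  let x : SliceVar m m₁ m₂ r → K := fun s => match s with
    | Sum.inl p => g.val p.1.1 p.1.2 * t p.1.2
    | Sum.inr (Sum.inl k) => a k
    | Sum.inr (Sum.inr (Sum.inl k)) => b k
    | Sum.inr (Sum.inr (Sum.inr (Sum.inl k))) => t' (Fin.castLE (by omega) k) * α k
    | Sum.inr (Sum.inr (Sum.inr (Sum.inr k))) => t ⟨(m - m₂) + k, by have := k.isLt; omega⟩ * β k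
  refine ⟨x, g * T, ?_, ?_⟩
  · ext i j
    simp only [Units.val_mul, T, Matrix.mul_diagonal, Matrix.map_apply, sliceMatrix,
      Matrix.of_apply]
    split
    · next hi =>
      subst hi
      simpa using mul_inv_cancel₀ (hg j)
    · simp [x]
  · simp only [slicePoint, psiPoint_eq_conjPoint]
    rw [← conjPoint_mul_diagonal g.val g⁻¹.val 1 t t' _ _ _ _ _ _ ht, alphaFull_mul _ (by omega),
      betaFull_mul _ (by omega), _root_.mul_inv_rev]
    rfl

/-- The value of `ψ` at the generic slice parameters. -/
abbrev genericSlicePoint (g : GL (Fin m) (FractionRing (MvPolynomial (SliceVar m m₁ m₂ r) K))) :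
    Pt (FractionRing (MvPolynomial (SliceVar m m₁ m₂ r) K)) m :=
  slicePoint g fun s => algebraMap (MvPolynomial (SliceVar m m₁ m₂ r) K) _ (X s)

/-- The ideal of `psiImage` is the ideal of relations satisfied by the generic slice point. -/
theorem vanishingIdeal_psiImage [Infinite K] (h : m₁ + m₂ ≤ m)
    (g : GL (Fin m) (FractionRing (MvPolynomial (SliceVar m m₁ m₂ r) K)))
    (hg : g.val = (sliceMatrix K m₁ m₂ r).map (algebraMap _ _)) :
    vanishingIdeal K (psiImage K m m₁ m₂) =
      RingHom.ker (aeval (R := K) (genericSlicePoint g)) := by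
  let φ : MvPolynomial (SliceVar m m₁ m₂ r) K →ₐ[K]
    FractionRing (MvPolynomial (SliceVar m m₁ m₂ r) K) := IsScalarTower.toAlgHom K _ _
  have hpt : genericSlicePoint g = slicePoint g fun s => φ (X s) := rfl
  rw [hpt, slicePoint_eq_conjPoint]
  ext p
  rw [RingHom.mem_ker, mem_vanishingIdeal_iff]
  constructor
  · intro hp
    let disc : MvPolynomial (SliceVar m m₁ m₂ r) K :=
      (Matrix.vandermonde fun k => X (Sum.inr (Sum.inl k))).det *
        (Matrix.vandermonde fun k => X (Sum.inr (Sum.inr (Sum.inl k)))).det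
    have hdisc : disc ≠ 0 := by
      refine mul_ne_zero (Matrix.det_vandermonde_ne_zero_iff.2 fun i j hij => ?_)
        (Matrix.det_vandermonde_ne_zero_iff.2 fun i j hij => ?_)
      · simpa using X_injective hij
      · simpa using X_injective hij
    refine aeval_conjPoint_eq_zero (sliceMatrix K m₁ m₂ r) (det_sliceMatrix_ne_zero K) _ _ _ _ _ _
      hdisc p (fun x gx hgx hx => ?_) φ g hg
    rw [← slicePoint_eq_conjPoint]
    simp only [disc, map_mul, mul_ne_zero_iff, Matrix.det_vandermonde, map_prod, map_sub,
      aeval_X] at hx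
    rw [← Matrix.det_vandermonde, ← Matrix.det_vandermonde, Matrix.det_vandermonde_ne_zero_iff,
      Matrix.det_vandermonde_ne_zero_iff] at hx
    refine hp _ ⟨gx, _, _, _, _, ?_, ?_, rfl⟩
    · simpa using hx.1
    · simpa using hx.2
  · rintro hp _ ⟨g₀, a, b, α, β, -, -, rfl⟩
    obtain ⟨q, hq⟩ := exists_numerator (sliceMatrix K m₁ m₂ r)
      (fun i => X (Sum.inr (Sum.inl (diagIdxA m₁ i))))
      (fun i => X (Sum.inr (Sum.inr (Sum.inl (diagIdxB m₂ i)))))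
      (extendAlpha m₁ fun k => X (Sum.inr (Sum.inr (Sum.inr (Sum.inl k)))))
      (extendBeta m₂ fun k => X (Sum.inr (Sum.inr (Sum.inr (Sum.inr k)))))
      (X (Sum.inr (Sum.inl 0))) (X (Sum.inr (Sum.inr (Sum.inl 0)))) p
    have hq0 : q = 0 := IsFractionRing.injective _ (FractionRing _)
      (((hq _ φ g hg).1 hp).trans (map_zero _).symm)
    have hslice (x : SliceVar m m₁ m₂ r → K) (gx : GL (Fin m) K)
        (hgx : gx.val = (sliceMatrix K m₁ m₂ r).map (aeval x)) :
        aeval (slicePoint gx x) p = 0 := by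
      have := (hq K (aeval x) gx hgx).2 (by rw [hq0, map_zero])
      rw [← slicePoint_eq_conjPoint] at this
      simpa using this
    let G : Matrix (Fin m) (Fin m) (MvPolynomial Unit K) :=
      g₀.val.map C + Matrix.of fun i _ => if i = r then X () else 0
    have hG0 : G.map (aeval (0 : Unit → K)) = g₀.val := by
      ext i j
      simp only [G, Matrix.map_apply, Matrix.add_apply, Matrix.of_apply, map_add, apply_ite,
        aeval_X]
      simp
    have hG : G.det ≠ 0 := by
      intro hG
      have h1 := AlgHom.map_det (aeval (0 : Unit → K) : MvPolynomial Unit K →ₐ[K] K) G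
      rw [AlgHom.mapMatrix_apply, hG0, hG, map_zero] at h1
      exact (Matrix.isUnits_det_units g₀).ne_zero h1.symm
    have hrow : ∏ j, (C (g₀.val r j) + X () : MvPolynomial Unit K) ≠ 0 := by
      refine Finset.prod_ne_zero_iff.2 fun j _ hj => ?_
      have := congrArg (eval fun _ : Unit => 1 - g₀.val r j) hj
      simp at this
    have key := aeval_conjPoint_eq_zero G hG (C ∘ diagA K m m₁ a) (C ∘ diagB K m m₂ b)
      (C ∘ alphaFull K m m₁ α) (C ∘ betaFull K m m₂ β) (C (a 0)) (C (b 0)) hrow p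
      (fun x gx hgx hx => ?_) (aeval (0 : Unit → K)) g₀ hG0.symm
    · rw [psiPoint_eq_conjPoint]
      simpa [Function.comp_def] using key
    · have hgr (j : Fin m) : gx.val r j ≠ 0 := by
        rw [map_prod, Finset.prod_ne_zero_iff] at hx
        have := hx j (Finset.mem_univ j)
        rw [hgx]
        simpa [G] using this
      obtain ⟨y, g', hg', hy⟩ := exists_slicePoint_eq h gx hgr a b α β
      have := hslice y g' hg'
      rw [hy, psiPoint_eq_conjPoint] at this
      simpa [Function.comp_def] using this

end Slice

section Recover

variable {F : Type} [Field F] {m : ℕ}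

/-- The tuples `c` for which `g·diag(c)·g⁻¹` has entries in a given subring. -/
def diagonalSubring (L : Subring F) (g : GL (Fin m) F) : Subring (Fin m → F) where
  carrier := {c | ∀ i j, (g.val * Matrix.diagonal c * g⁻¹.val) i j ∈ L}
  mul_mem' {c c'} hc hc' i j := by
    have : g.val * Matrix.diagonal (c * c') * g⁻¹.val =
        (g.val * Matrix.diagonal c * g⁻¹.val) * (g.val * Matrix.diagonal c' * g⁻¹.val) := by
      rw [Pi.mul_def, ← Matrix.diagonal_mul_diagonal]
      simp only [Matrix.mul_assoc, Units.inv_mul_cancel_left]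
    rw [this, Matrix.mul_apply]
    exact L.sum_mem fun k _ => L.mul_mem (hc i k) (hc' k j)
  one_mem' i j := by
    rw [Pi.one_def, Matrix.diagonal_one, mul_one, Units.mul_inv, Matrix.one_apply]
    split
    · exact L.one_mem
    · exact L.zero_mem
  add_mem' {c c'} hc hc' i j := by
    rw [Pi.add_def, ← Matrix.diagonal_add, Matrix.mul_add, Matrix.add_mul]
    exact L.add_mem (hc i j) (hc' i j)
  zero_mem' i j := by
    simp [Pi.zero_def]
  neg_mem' {c} hc i j := by
    rw [Pi.neg_def, ← Matrix.diagonal_neg, Matrix.mul_neg, Matrix.neg_mul]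
    exact L.neg_mem (hc i j)

theorem const_mem_diagonalSubring {L : Subring F} (g : GL (Fin m) F) {x : F} (hx : x ∈ L) :
    (fun _ => x) ∈ diagonalSubring L g := by
  intro i j
  rw [← Matrix.smul_one_eq_diagonal, Matrix.mul_smul, mul_one, Matrix.smul_mul, Units.mul_inv,
    Matrix.smul_apply, Matrix.one_apply]
  split
  · simpa using hx
  · simp

/-- Eigenvalues of a matrix over `L` are integral over `L`. -/
theorem isIntegral_of_mem_diagonalSubring {L : Subring F} {g : GL (Fin m) F} {c : Fin m → F}
    (hc : c ∈ diagonalSubring L g) (i : Fin m) : IsIntegral L (c i) := by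
  let M : Matrix (Fin m) (Fin m) L := Matrix.of fun k l => ⟨_, hc k l⟩
  have hM : M.map (algebraMap L F) = g.val * Matrix.diagonal c * g⁻¹.val := rfl
  refine ⟨M.charpoly, M.charpoly_monic, ?_⟩
  rw [← Polynomial.eval_map, ← Matrix.charpoly_map, hM, Matrix.coe_units_inv,
    Matrix.charpoly_units_conj, Matrix.charpoly_diagonal, Polynomial.eval_prod]
  exact Finset.prod_eq_zero (Finset.mem_univ i) (by simp)

theorem single_mem_diagonalSubring {L : Subfield F} {g : GL (Fin m) F} {d e : Fin m → F}
    (hd : d ∈ diagonalSubring L.toSubring g) (he : e ∈ diagonalSubring L.toSubring g)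
    (hd' : ∀ i, d i ∈ L) (he' : ∀ i, e i ∈ L)
    (hde : ∀ i j, i ≠ j → d i ≠ d j ∨ e i ≠ e j) (i : Fin m) :
    Pi.single i 1 ∈ diagonalSubring L.toSubring g := by
  have sep (c : Fin m → F) (hc : c ∈ diagonalSubring L.toSubring g) (hc' : ∀ i, c i ∈ L)
      (j : Fin m) (hij : c i ≠ c j) :
      ∃ f ∈ diagonalSubring L.toSubring g, f i = 1 ∧ f j = 0 := by
    refine ⟨(fun _ => (c i - c j)⁻¹) * (c - fun _ => c j), Subring.mul_mem _
      (const_mem_diagonalSubring g (L.inv_mem (L.sub_mem (hc' i) (hc' j))))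
      (Subring.sub_mem _ hc (const_mem_diagonalSubring g (hc' j))), ?_, ?_⟩
    · simpa using inv_mul_cancel₀ (sub_ne_zero.2 hij)
    · simp
  have hf (j : Fin m) :
      ∃ f ∈ diagonalSubring L.toSubring g, f i = 1 ∧ (j ≠ i → f j = 0) := by
    by_cases hij : j = i
    · exact ⟨1, Subring.one_mem _, rfl, fun h => absurd hij h⟩
    · rcases hde i j (Ne.symm hij) with h | h
      · obtain ⟨f, h1, h2, h3⟩ := sep d hd hd' j h
        exact ⟨f, h1, h2, fun _ => h3⟩
      · obtain ⟨f, h1, h2, h3⟩ := sep e he he' j h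
        exact ⟨f, h1, h2, fun _ => h3⟩
  choose f hfm hf1 hf0 using hf
  have : Pi.single i 1 = ∏ j, f j := by
    funext k
    rw [Finset.prod_apply]
    by_cases hk : k = i
    · subst hk
      simp [hf1]
    · rw [Pi.single_eq_of_ne hk]
      exact (Finset.prod_eq_zero (f := fun j => f j k) (Finset.mem_univ k) (hf0 k hk)).symm
  rw [this]
  exact Subring.prod_mem _ fun j _ => hfm j

/-- The parameters of a `conjPoint` with separated diagonals and normalized row are algebraic
over its coordinates. -/
theorem mem_of_conjPoint_mem (L : Subfield F) (hL : ∀ x : F, IsIntegral L x → x ∈ L)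
    (g : GL (Fin m) F) (r : Fin m) (hr : ∀ j, g.val r j = 1) {d e u v : Fin m → F} {a b : F}
    (hde : ∀ i j, i ≠ j → d i ≠ d j ∨ e i ≠ e j)
    (hz : ∀ s, conjPoint g.val g⁻¹.val 1 d e u v a b s ∈ L) :
    (∀ i j, g.val i j ∈ L) ∧ (∀ i, d i ∈ L) ∧ (∀ i, e i ∈ L) ∧ (∀ i, u i ∈ L) ∧ (∀ i, v i ∈ L) ∧
      a ∈ L ∧ b ∈ L := by
  have hd : d ∈ diagonalSubring L.toSubring g := fun i j => hz (Sum.inl (i, j))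
  have he : e ∈ diagonalSubring L.toSubring g := fun i j => hz (Sum.inr (Sum.inl (i, j)))
  have hd' (i : Fin m) : d i ∈ L := hL _ (isIntegral_of_mem_diagonalSubring hd i)
  have he' (i : Fin m) : e i ∈ L := hL _ (isIntegral_of_mem_diagonalSubring he i)
  have hE (k i s : Fin m) : g.val k i * g⁻¹.val i s ∈ L := by
    have := single_mem_diagonalSubring hd he hd' he' hde i k s
    simpa [Matrix.mul_apply, Matrix.diagonal_apply, Pi.single_apply] using this
  have hh (i s : Fin m) : g⁻¹.val i s ∈ L := by simpa [hr] using hE r i s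
  have hg (k i : Fin m) : g.val k i ∈ L := by
    obtain ⟨s, hs⟩ : ∃ s, g⁻¹.val i s ≠ 0 := by
      by_contra! hs
      have := congrFun (congrFun (Units.inv_mul g) i) i
      rw [Matrix.mul_apply] at this
      simp only [hs, zero_mul, Finset.sum_const_zero, Matrix.one_apply_eq, zero_ne_one] at this
    rw [← mul_div_cancel_right₀ (g.val k i) hs]
    exact L.div_mem (hE k i s) (hh i s)
  refine ⟨hg, hd', he', fun i => ?_, fun i => ?_, ?_, ?_⟩
  · have : u = g⁻¹.val *ᵥ (g.val *ᵥ u) := by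
      rw [Matrix.mulVec_mulVec, Units.inv_mul, Matrix.one_mulVec]
    rw [this, Matrix.mulVec, dotProduct]
    refine L.sum_mem fun k _ => L.mul_mem (hh i k) ?_
    simpa [conjPoint] using hz (Sum.inr (Sum.inr (Sum.inl k)))
  · have : v = (v ᵥ* g⁻¹.val) ᵥ* g.val := by
      rw [Matrix.vecMul_vecMul, Units.inv_mul, Matrix.vecMul_one]
    rw [this, Matrix.vecMul, dotProduct]
    exact L.sum_mem fun k _ => L.mul_mem (hz (Sum.inr (Sum.inr (Sum.inr (Sum.inl k))))) (hg k i)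
  · simpa [conjPoint] using hz (Sum.inr (Sum.inr (Sum.inr (Sum.inr 0))))
  · simpa [conjPoint] using hz (Sum.inr (Sum.inr (Sum.inr (Sum.inr 1))))

end Recover

section Dimension

variable {K : Type} [Field K] {m m₁ m₂ : ℕ} {r : Fin m}

/-- The slice parameters are algebraic over the coordinates of the generic slice point. -/
theorem mem_of_slicePoint_mem {F : Type} [Field F] [Algebra K F] (h : m₁ + m₂ ≤ m)
    (φ : MvPolynomial (SliceVar m m₁ m₂ r) K →ₐ[K] F) (hφ : Function.Injective φ)
    (g : GL (Fin m) F) (hg : g.val = (sliceMatrix K m₁ m₂ r).map φ)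
    (L : Subfield F) (hL : ∀ x : F, IsIntegral L x → x ∈ L)
    (hz : ∀ s, slicePoint g (fun s => φ (X s)) s ∈ L) (s : SliceVar m m₁ m₂ r) :
    φ (X s) ∈ L := by
  rw [slicePoint_eq_conjPoint] at hz
  obtain ⟨hgL, hd, he, hu, hv, ha, hb⟩ := mem_of_conjPoint_mem L hL g r
    (fun j => by simp [hg, sliceMatrix]) (fun i j hij => (diagIdx_ne m₁ m₂ h hij).imp
      (fun hne heq => hne (by simpa using X_injective (hφ heq)))
      (fun hne heq => hne (by simpa using X_injective (hφ heq)))) hz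
  rcases s with ⟨⟨i, j⟩, hi⟩ | k | k | k | k
  · have := hgL i j
    rw [hg] at this
    have hi' : i ≠ r := hi
    simpa [sliceMatrix, hi'] using this
  · by_cases hk : k = 0
    · exact hk ▸ ha
    · have hk0 : (k : ℕ) ≠ 0 := fun h0 => hk (Fin.ext h0)
      have hk' := k.isLt
      have := hd ⟨m₁ + k - 1, by omega⟩
      have hidx : diagIdxA m₁ (⟨m₁ + k - 1, by omega⟩ : Fin m) = k := by
        rw [diagIdxA, dif_neg (by simp only; omega), Fin.ext_iff]
        simp only
        omega
      rwa [Function.comp_apply, hidx] at this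
  · by_cases hk : k = 0
    · exact hk ▸ hb
    · have hk0 : (k : ℕ) ≠ 0 := fun h0 => hk (Fin.ext h0)
      have hk' := k.isLt
      have := he ⟨k - 1, by omega⟩
      have hidx : diagIdxB m₂ (⟨k - 1, by omega⟩ : Fin m) = k := by
        rw [diagIdxB, dif_pos (by simp only; omega), Fin.ext_iff]
        simp only
        omega
      rwa [Function.comp_apply, hidx] at this
  · have := hu (Fin.castLE (by omega) k)
    simpa [extendAlpha] using this
  · have hk := k.isLt
    have := hv ⟨m - m₂ + k, by omega⟩
    simpa [extendBeta] using this

theorem trdeg_range_aeval_slicePoint (h : m₁ + m₂ ≤ m)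
    (g : GL (Fin m) (FractionRing (MvPolynomial (SliceVar m m₁ m₂ r) K)))
    (hg : g.val = (sliceMatrix K m₁ m₂ r).map (algebraMap _ _)) :
    Algebra.trdeg K (aeval (R := K) (genericSlicePoint g)).range =
      (m ^ 2 + m + 2 : ℕ) := by
  let R := MvPolynomial (SliceVar m m₁ m₂ r) K
  let F := FractionRing R
  let φ : R →ₐ[K] F := IsScalarTower.toAlgHom K _ _
  let z : Pt F m := genericSlicePoint g
  let E : IntermediateField K F := IntermediateField.adjoin K (Set.range z)
  have hφ : Function.Injective φ := IsFractionRing.injective R F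
  have : Algebra.IsIntegral E (algebraicClosure E F) :=
    algebraicClosure.isAlgebraic E F |>.isIntegral
  have hX (s : SliceVar m m₁ m₂ r) : algebraMap R F (X s) ∈ algebraicClosure E F := by
    refine mem_of_slicePoint_mem h φ hφ g hg (algebraicClosure E F).toSubfield
      (fun x hx => ?_) (fun s => ?_) s
    · exact mem_algebraicClosure_iff.2
        (isIntegral_trans (R := E) (A := algebraicClosure E F) x hx).isAlgebraic
    · exact (algebraicClosure E F).algebraMap_mem
        ⟨z s, IntermediateField.subset_adjoin K _ ⟨s, rfl⟩⟩
  have htop (x : F) : IsAlgebraic E x := by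
    obtain ⟨p, q, -, rfl⟩ := IsFractionRing.div_surjective (A := R) x
    have hp (p : R) : algebraMap R F p ∈ algebraicClosure E F := by
      induction p using MvPolynomial.induction_on with
      | C c =>
        exact (algebraicClosure E F).algebraMap_mem (algebraMap K E c)
      | add p q hp hq => rw [map_add]; exact add_mem hp hq
      | mul_X p s hp => rw [map_mul]; exact mul_mem hp (hX s)
    exact mem_algebraicClosure_iff.1 (div_mem (hp p) (hp q))
  have hEF : Algebra.IsAlgebraic E F := ⟨htop⟩
  rw [IntermediateField.isAlgebraic_adjoin_iff_top] at hEF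
  have hAF := trdeg_add_eq K (Algebra.adjoin K (Set.range z)) (A := F)
  have hRF := trdeg_add_eq K R (A := F)
  have : Algebra.IsAlgebraic R F := IsLocalization.isAlgebraic _ (nonZeroDivisors R)
  rw [trdeg_eq_zero (R := Algebra.adjoin K (Set.range z)) (A := F), add_zero] at hAF
  rw [trdeg_eq_zero (R := R) (A := F), add_zero] at hRF
  rw [← Algebra.adjoin_range_eq_range_aeval, hAF, ← hRF, MvPolynomial.trdeg_of_isDomain,
    Cardinal.lift_uzero, Cardinal.mk_fintype]
  exact congrArg Nat.cast
    ((Fintype.card_congr' rfl).trans (card_sliceVar m₁ m₂ (by omega) (by omega) r))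

end Dimension

/-- For every `m ≥ 1` and `0 ≤ m₁, m₂` with `m₁ + m₂ ≤ m`, the image of `ψ_{m,m₁,m₂}` is an
irreducible subset of `CV(m)` of dimension `m² + m + 2` (the dimension of a subset being the
Krull dimension of its Zariski closure). -/
theorem psiImage_irreducible_and_dim (K : Type) [Field K] [IsAlgClosed K]
    (m : ℕ) (hm : 1 ≤ m) (m₁ m₂ : ℕ) (h : m₁ + m₂ ≤ m) :
    IsIrreducible (psiImage K m m₁ m₂) ∧
      topologicalKrullDim ↥(closure (psiImage K m m₁ m₂)) =
        ((m ^ 2 + m + 2 : ℕ) : WithBot ℕ∞) := by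
  let r : Fin m := ⟨0, hm⟩
  let R := MvPolynomial (SliceVar m m₁ m₂ r) K
  let F := FractionRing R
  have hdet : ((sliceMatrix K m₁ m₂ r).map (algebraMap R F)).det ≠ 0 := by
    rw [← RingHom.mapMatrix_apply, ← RingHom.map_det]
    exact (map_ne_zero_iff _ (IsFractionRing.injective R F)).2 (det_sliceMatrix_ne_zero K)
  let g : GL (Fin m) F := Matrix.GeneralLinearGroup.mkOfDetNeZero _ hdet
  have hg : g.val = (sliceMatrix K m₁ m₂ r).map (algebraMap R F) := rfl
  have : Infinite K := IsAlgClosed.instInfinite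
  have hI := vanishingIdeal_psiImage h g hg
  have ht : (inferInstance : TopologicalSpace (Pt K m)) = zariskiTopology K (CVvar m) := rfl
  refine ⟨(isIrreducible_iff_isPrime_vanishingIdeal ht _).2 ?_, ?_⟩
  · rw [hI]
    exact RingHom.ker_isPrime _
  · let f := aeval (R := K) (genericSlicePoint g)
    rw [topologicalKrullDim_closure_eq ht, hI.trans f.ker_rangeRestrict.symm,
      ringKrullDim_eq_of_ringEquiv
        (Ideal.quotientKerAlgEquivOfSurjective f.rangeRestrict_surjective).toRingEquiv]
    have : Algebra.FiniteType K f.range :=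
      Algebra.FiniteType.of_surjective f.rangeRestrict f.rangeRestrict_surjective
    exact ringKrullDim_eq_of_trdeg_eq (trdeg_range_aeval_slicePoint h g hg)
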